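/- Assume the Lr (a,τ) interval exchange transformation T has no periodic points (no x ∈ [0,1) and k ≥ 1 with T^k x = x). If α, β are distinct points of X and α ∈ X₀, then the pair α, β is neither positively nor negatively asymptotic. -/

import Mathlib

open Set

noncomputable section

/-- `bpt a k = a_1 + ⋯ + a_k` (0-indexed: the sum of the first `k` entries of `a`);
these are the division points `b_k` of the interval exchange. -/
def bpt {n : ℕ} (a : Fin n → ℝ) (k : ℕ) : ℝ :=
  ∑ j ∈ Finset.univ.filter (fun j : Fin n => (j : ℕ) < k), a j

/-- The left-closed right-open interval `J_i = [b_{i-1}, b_i)` (0-indexed). -/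
def Jint {n : ℕ} (a : Fin n → ℝ) (i : Fin n) : Set ℝ :=
  Set.Ico (bpt a (i : ℕ)) (bpt a ((i : ℕ) + 1))

/-- The left-open right-closed interval `J̃_i = (b_{i-1}, b_i]` (0-indexed). -/
def Jtil {n : ℕ} (a : Fin n → ℝ) (i : Fin n) : Set ℝ :=
  Set.Ioc (bpt a (i : ℕ)) (bpt a ((i : ℕ) + 1))

/-- The permuted probability vector `a^τ`, with `a^τ_{τ(i)} = a_i`. -/
def aperm {n : ℕ} (a : Fin n → ℝ) (τ : Equiv.Perm (Fin n)) : Fin n → ℝ :=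
  fun j => a (τ.symm j)

/-- The set `D = {b_1, …, b_{n-1}}` of interior division points. -/
def Dset {n : ℕ} (a : Fin n → ℝ) : Set ℝ :=
  {x | ∃ k : ℕ, 0 < k ∧ k < n ∧ x = bpt a k}

/-- `a` is a positive probability vector. -/
def IsProbVec {n : ℕ} (a : Fin n → ℝ) : Prop :=
  (∀ i, 0 < a i) ∧ ∑ i, a i = 1

/-- `T` is the Lr `(a,τ)` interval exchange transformation: on each
`J_i = [b_{i-1}, b_i)` it is the translation `x ↦ x - b_{i-1} + b^τ_{τ(i)-1}`. -/
def IsLrIET {n : ℕ} (a : Fin n → ℝ) (τ : Equiv.Perm (Fin n)) (T : ℝ → ℝ) : Prop :=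
  ∀ i : Fin n, ∀ x ∈ Jint a i, T x = x - bpt a (i : ℕ) + bpt (aperm a τ) ((τ i : ℕ))

/-- `Tt` is the dual lR `(a,τ)` interval exchange transformation: on each
`J̃_i = (b_{i-1}, b_i]` it is the translation `x ↦ x - b_{i-1} + b^τ_{τ(i)-1}`. -/
def IslRIET {n : ℕ} (a : Fin n → ℝ) (τ : Equiv.Perm (Fin n)) (Tt : ℝ → ℝ) : Prop :=
  ∀ i : Fin n, ∀ x ∈ Jtil a i, Tt x = x - bpt a (i : ℕ) + bpt (aperm a τ) ((τ i : ℕ))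

/-- The Keane Condition: `D ∩ T^k(D) = ∅` for every positive integer `k`. -/
def KeaneCond {n : ℕ} (a : Fin n → ℝ) (T : ℝ → ℝ) : Prop :=
  ∀ k : ℕ, 0 < k → Dset a ∩ (T^[k] '' Dset a) = ∅

/-- `τ` is irreducible: `τ({1,…,j}) ≠ {1,…,j}` for `j = 1, …, n-1` (0-indexed:
no proper initial segment is invariant). -/
def IrreduciblePerm {n : ℕ} (τ : Equiv.Perm (Fin n)) : Prop :=
  ∀ j : ℕ, 0 < j → j < n →
    (fun i => τ i) '' {i : Fin n | (i : ℕ) < j} ≠ {i : Fin n | (i : ℕ) < j}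

/-- `P` is the family of ℤ-iterates of `T` on `[0,1)`: `P 0 = id`,
`P (k+1) = T ∘ P k`, and each `P k` maps `[0,1)` into itself. -/
def IsZIterLr (T : ℝ → ℝ) (P : ℤ → ℝ → ℝ) : Prop :=
  (∀ x ∈ Set.Ico (0 : ℝ) 1, P 0 x = x) ∧
  ∀ k : ℤ, ∀ x ∈ Set.Ico (0 : ℝ) 1, P k x ∈ Set.Ico (0 : ℝ) 1 ∧ P (k + 1) x = T (P k x)

/-- `Pt` is the family of ℤ-iterates of `Tt` on `(0,1]`. -/
def IsZIterlR (Tt : ℝ → ℝ) (Pt : ℤ → ℝ → ℝ) : Prop :=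
  (∀ x ∈ Set.Ioc (0 : ℝ) 1, Pt 0 x = x) ∧
  ∀ k : ℤ, ∀ x ∈ Set.Ioc (0 : ℝ) 1, Pt k x ∈ Set.Ioc (0 : ℝ) 1 ∧ Pt (k + 1) x = Tt (Pt k x)

/-- `I` is the itinerary map of `T` (with ℤ-iterates `P`):
`𝓘(x)_k = i ↔ T^k x ∈ J_i` for `x ∈ [0,1)`. -/
def IsItin {n : ℕ} (a : Fin n → ℝ) (P : ℤ → ℝ → ℝ) (I : ℝ → ℤ → Fin n) : Prop :=
  ∀ x ∈ Set.Ico (0 : ℝ) 1, ∀ k : ℤ, ∀ i : Fin n, (I x k = i ↔ P k x ∈ Jint a i)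

/-- `It` is the itinerary map of `Tt` (with ℤ-iterates `Pt`):
`𝓘̃(x)_k = i ↔ T̃^k x ∈ J̃_i` for `x ∈ (0,1]`. -/
def IsItinDual {n : ℕ} (a : Fin n → ℝ) (Pt : ℤ → ℝ → ℝ) (It : ℝ → ℤ → Fin n) : Prop :=
  ∀ x ∈ Set.Ioc (0 : ℝ) 1, ∀ k : ℤ, ∀ i : Fin n, (It x k = i ↔ Pt k x ∈ Jtil a i)

/-- `D_∞ = {0,1} ∪ ⋃_{k ∈ ℤ} T^k(D)`. -/
def Dinf {n : ℕ} (a : Fin n → ℝ) (P : ℤ → ℝ → ℝ) : Set ℝ :=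
  {0, 1} ∪ ⋃ k : ℤ, P k '' Dset a

/-- The set `R = [0,1] ∖ D_∞` of regular points. -/
def Rset {n : ℕ} (a : Fin n → ℝ) (P : ℤ → ℝ → ℝ) : Set ℝ :=
  Set.Icc 0 1 \ Dinf a P

/-- The shift `S` on `Ω = {1,…,n}^ℤ`: `S(α)_i = α_{i+1}`. -/
def shiftS {n : ℕ} (α : ℤ → Fin n) : ℤ → Fin n := fun i => α (i + 1)

/-- The `k`-th power of the shift: `(S^k α)_i = α_{i+k}`. -/
def shiftZ {n : ℕ} (k : ℤ) (α : ℤ → Fin n) : ℤ → Fin n := fun i => α (i + k)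

/-- `α, β` are positively asymptotic: `α_i = β_i` for all `i ≥ N`, some `N`. -/
def PosAsymp {n : ℕ} (α β : ℤ → Fin n) : Prop :=
  ∃ N : ℕ, ∀ i : ℤ, (N : ℤ) ≤ i → α i = β i

/-- `α, β` are negatively asymptotic: `α_i = β_i` for all `i ≤ -N`, some `N`. -/
def NegAsymp {n : ℕ} (α β : ℤ → Fin n) : Prop :=
  ∃ N : ℕ, ∀ i : ℤ, i ≤ -(N : ℤ) → α i = β i

/-- If an orbit `x` running through the interiors of intervals `[l i, l i + w i]` and an orbit `y`
running through the closed intervals are eventually in the same intervals at the same times, and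
the intervals as well as their translates by `t` do not overlap, then `x` and `y` have the same
itinerary, provided that `x` is bounded and injective. -/
theorem itinerary_eq_of_eventually_eq {ι : Type*} {l w t : ι → ℝ} {x y : ℤ → ℝ} {α β : ℤ → ι}
    (hl : ∀ i j, i ≠ j → l i + w i ≤ l j ∨ l j + w j ≤ l i)
    (hlt : ∀ i j, i ≠ j → l i + t i + w i ≤ l j + t j ∨ l j + t j + w j ≤ l i + t i)
    (hx : ∀ k, l (α k) < x k ∧ x k < l (α k) + w (α k))
    (hy : ∀ k, l (β k) ≤ y k ∧ y k ≤ l (β k) + w (β k))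
    (hx_succ : ∀ k, x (k + 1) = x k + t (α k)) (hy_succ : ∀ k, y (k + 1) = y k + t (β k))
    (hx_mem : ∀ k, x k ∈ Icc (0 : ℝ) 1) (hx_inj : Function.Injective x) {N : ℤ}
    (hαβ : ∀ k, N ≤ k → α k = β k) : α = β := by
  have hdiff : ∀ m : ℕ, y (N + m) - x (N + m) = y N - x N := by
    intro m
    induction m with
    | zero => simp
    | succ m ih =>
      have h1 := hx_succ (N + m)
      have h2 := hy_succ (N + m)
      rw [hαβ (N + m) (by omega)] at h1
      push_cast
      rw [← add_assoc]
      linarith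
  have hdiff' : ∀ k, N ≤ k → y k - x k = y N - x N := by
    intro k hk
    obtain ⟨m, rfl⟩ := Int.le.dest hk
    exact hdiff m
  have hN : y N = x N := by
    by_contra hδ
    have hpos : 0 < |y N - x N| := abs_pos.2 (sub_ne_zero.2 hδ)
    obtain ⟨p, hp, hclose⟩ : ∃ p : ℤ × ℤ, (N ≤ p.1 ∧ p.1 < p.2) ∧
        |x p.2 - x p.1| < |y N - x N| := by
      obtain ⟨z, -, φ, hφ, hlim⟩ := isCompact_Icc.tendsto_subseq
        (x := fun m : ℕ => x (N + m)) fun m => hx_mem _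
      obtain ⟨M, hM⟩ := Metric.cauchySeq_iff'.1 hlim.cauchySeq _ hpos
      have hlt := hφ (Nat.lt_succ_self M)
      refine ⟨(N + φ M, N + φ (M + 1)), ⟨by simp, by simpa using hlt⟩, ?_⟩
      simpa [Real.dist_eq] using hM (M + 1) (by omega)
    obtain ⟨j, k⟩ := p
    simp only at hp hclose
    have hshift : ∀ i : ℕ, x (k + i) - x (j + i) = x k - x j := by
      intro i
      induction i with
      | zero => simp
      | succ i ih =>
        have hα : α (j + i) = α (k + i) := by
          by_contra hne
          have hj := hdiff' (j + i) (by omega)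
          have hk := hdiff' (k + i) (by omega)
          have hxj := hx (j + i)
          have hxk := hx (k + i)
          have hyj := hy (j + i)
          have hyk := hy (k + i)
          rw [← hαβ _ (by omega)] at hyj hyk
          have hc := abs_lt.1 hclose
          rcases hl _ _ hne with h | h <;>
            rcases abs_cases (y N - x N) with ⟨h', -⟩ | ⟨h', -⟩ <;>
            linarith [hc.1, hc.2, hxj.1, hxj.2, hxk.1, hxk.2, hyj.1, hyj.2, hyk.1, hyk.2]
        have h1 := hx_succ (j + i)
        have h2 := hx_succ (k + i)
        rw [hα] at h1
        push_cast
        rw [← add_assoc, ← add_assoc]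
        linarith
    obtain ⟨m, rfl⟩ := Int.le.dest hp.2.le
    have hmul : ∀ i : ℕ, x (j + (i * m : ℕ)) = x j + i * (x (j + m) - x j) := by
      intro i
      induction i with
      | zero => simp
      | succ i ih =>
        have h := hshift (i * m)
        have he : j + ((i + 1) * m : ℕ) = j + m + (i * m : ℕ) := by push_cast; ring
        rw [he]
        push_cast at *
        linarith
    have hc : x (j + m) - x j ≠ 0 := sub_ne_zero.2 (hx_inj.ne hp.2.ne')
    obtain ⟨i, hi⟩ := exists_nat_gt (1 / |x (j + m) - x j|)
    rw [div_lt_iff₀ (abs_pos.2 hc)] at hi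
    have hi' : |(i : ℝ) * (x (j + m) - x j)| ≤ 1 := by
      rw [← add_sub_cancel_left (x j) ((i : ℝ) * (x (j + m) - x j)), ← hmul i, abs_le]
      have h1 := hx_mem (j + (i * m : ℕ))
      have h2 := hx_mem j
      exact ⟨by linarith [h1.1, h2.2], by linarith [h1.2, h2.1]⟩
    rw [abs_mul, Nat.abs_cast] at hi'
    linarith
  have hback : ∀ k, y (k + 1) = x (k + 1) → α k = β k ∧ y k = x k := by
    intro k hk
    have hα : α k = β k := by
      by_contra hne
      have h1 := hx_succ k
      have h2 := hy_succ k
      rcases hlt _ _ hne with h | h <;> linarith [(hx k).1, (hx k).2, (hy k).1, (hy k).2]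
    refine ⟨hα, ?_⟩
    have h1 := hx_succ k
    have h2 := hy_succ k
    rw [hα] at h1
    linarith
  have hxy : ∀ m : ℕ, y (N - m) = x (N - m) := by
    intro m
    induction m with
    | zero => simpa using hN
    | succ m ih =>
      refine (hback _ ?_).2
      have he : N - ((m + 1 : ℕ) : ℤ) + 1 = N - m := by push_cast; ring
      rw [he, ih]
  funext k
  rcases le_or_gt N k with hk | hk
  · exact hαβ k hk
  · refine (hback k ?_).1
    obtain ⟨m, hm⟩ := Int.le.dest (Int.add_one_le_of_lt hk)
    rw [eq_sub_of_add_eq hm]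
    exact hxy m

/-- The time reversal of `itinerary_eq_of_eventually_eq`. -/
theorem itinerary_eq_of_eventually_eq_atBot {ι : Type*} {l w t : ι → ℝ} {x y : ℤ → ℝ}
    {α β : ℤ → ι}
    (hl : ∀ i j, i ≠ j → l i + w i ≤ l j ∨ l j + w j ≤ l i)
    (hlt : ∀ i j, i ≠ j → l i + t i + w i ≤ l j + t j ∨ l j + t j + w j ≤ l i + t i)
    (hx : ∀ k, l (α k) < x k ∧ x k < l (α k) + w (α k))
    (hy : ∀ k, l (β k) ≤ y k ∧ y k ≤ l (β k) + w (β k))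
    (hx_succ : ∀ k, x (k + 1) = x k + t (α k)) (hy_succ : ∀ k, y (k + 1) = y k + t (β k))
    (hx_mem : ∀ k, x k ∈ Icc (0 : ℝ) 1) (hx_inj : Function.Injective x) {N : ℤ}
    (hαβ : ∀ k, k ≤ N → α k = β k) : α = β := by
  have hx_pred : ∀ k, x (-k) = x (-k - 1) + t (α (-k - 1)) := fun k => by
    simpa using hx_succ (-k - 1)
  have hy_pred : ∀ k, y (-k) = y (-k - 1) + t (β (-k - 1)) := fun k => by
    simpa using hy_succ (-k - 1)
  have h := itinerary_eq_of_eventually_eq (l := fun i => l i + t i) (w := w) (t := fun i => -t i)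
    (x := fun k => x (-k)) (y := fun k => y (-k)) (α := fun k => α (-k - 1))
    (β := fun k => β (-k - 1)) (N := -N - 1) hlt (by simpa using hl)
    (fun k => by
      have := hx (-k - 1)
      simp only [hx_pred k]
      exact ⟨by linarith [this.1], by linarith [this.2]⟩)
    (fun k => by
      have := hy (-k - 1)
      simp only [hy_pred k]
      exact ⟨by linarith [this.1], by linarith [this.2]⟩)
    (fun k => by
      have := hx_pred k
      rw [show -(k + 1) = -k - 1 by ring]
      linarith)
    (fun k => by
      have := hy_pred k
      rw [show -(k + 1) = -k - 1 by ring]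
      linarith)
    (fun k => hx_mem _) (hx_inj.comp neg_injective) (fun k hk => hαβ _ (by omega))
  funext k
  simpa using congrFun h (-k - 1)

theorem bpt_zero {n : ℕ} (a : Fin n → ℝ) : bpt a 0 = 0 := by
  simp [bpt]

theorem bpt_succ {n : ℕ} (a : Fin n → ℝ) (i : Fin n) :
    bpt a ((i : ℕ) + 1) = bpt a (i : ℕ) + a i := by
  have h : Finset.univ.filter (fun j : Fin n => (j : ℕ) < (i : ℕ) + 1) =
      insert i (Finset.univ.filter fun j : Fin n => (j : ℕ) < (i : ℕ)) := by
    ext j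
    simp only [Finset.mem_filter, Finset.mem_univ, true_and, Finset.mem_insert, Fin.ext_iff]
    omega
  rw [bpt, h, Finset.sum_insert (by simp), add_comm, bpt]

theorem bpt_mono {n : ℕ} {a : Fin n → ℝ} (ha : ∀ i, 0 ≤ a i) : Monotone (bpt a) := by
  intro k m hkm
  refine Finset.sum_le_sum_of_subset_of_nonneg ?_ fun i _ _ => ha i
  intro j
  simp only [Finset.mem_filter, Finset.mem_univ, true_and]
  omega

theorem bpt_nonneg {n : ℕ} {a : Fin n → ℝ} (ha : ∀ i, 0 ≤ a i) (k : ℕ) : 0 ≤ bpt a k :=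
  Finset.sum_nonneg fun i _ => ha i

theorem bpt_not_overlap {n : ℕ} {a : Fin n → ℝ} (ha : ∀ i, 0 ≤ a i) {i j : Fin n} (h : i ≠ j) :
    bpt a (i : ℕ) + a i ≤ bpt a (j : ℕ) ∨ bpt a (j : ℕ) + a j ≤ bpt a (i : ℕ) := by
  rw [← bpt_succ, ← bpt_succ]
  rcases lt_or_gt_of_ne h with h | h
  · exact Or.inl (bpt_mono ha h)
  · exact Or.inr (bpt_mono ha h)

theorem bpt_aperm_not_overlap {n : ℕ} {a : Fin n → ℝ} (ha : ∀ i, 0 ≤ a i)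
    (τ : Equiv.Perm (Fin n)) {i j : Fin n} (h : i ≠ j) :
    bpt (aperm a τ) (τ i : ℕ) + a i ≤ bpt (aperm a τ) (τ j : ℕ) ∨
      bpt (aperm a τ) (τ j : ℕ) + a j ≤ bpt (aperm a τ) (τ i : ℕ) := by
  simpa [aperm] using
    bpt_not_overlap (a := aperm a τ) (fun i => ha (τ.symm i)) (τ.injective.ne h)

section Orbit

variable {n : ℕ} {a : Fin n → ℝ} {τ : Equiv.Perm (Fin n)} {T : ℝ → ℝ} {P : ℤ → ℝ → ℝ}
  {I : ℝ → ℤ → Fin n}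

theorem IsItin.mem_Jint (hI : IsItin a P I) {x : ℝ} (hx : x ∈ Ico (0 : ℝ) 1) (k : ℤ) :
    P k x ∈ Jint a (I x k) :=
  (hI x hx k _).1 rfl

theorem IsItin.mem_Jint_zero (hP : IsZIterLr T P) (hI : IsItin a P I) {x : ℝ}
    (hx : x ∈ Ico (0 : ℝ) 1) : x ∈ Jint a (I x 0) := by
  have h := hI.mem_Jint hx 0
  rwa [hP.1 x hx] at h

theorem IsLrIET.injOn (ha : ∀ i, 0 ≤ a i) (hT : IsLrIET a τ T) (hP : IsZIterLr T P)
    (hI : IsItin a P I) : InjOn T (Ico (0 : ℝ) 1) := by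
  intro x hx y hy hxy
  have hxJ := hI.mem_Jint_zero hP hx
  have hyJ := hI.mem_Jint_zero hP hy
  rw [hT _ _ hxJ, hT _ _ hyJ] at hxy
  rw [Jint, bpt_succ, mem_Ico] at hxJ hyJ
  by_cases h : I x 0 = I y 0
  · rw [h] at hxy
    linarith
  · rcases bpt_aperm_not_overlap ha τ h with h | h <;> linarith [hxJ.1, hxJ.2, hyJ.1, hyJ.2]

theorem IsZIterLr.apply_add (hP : IsZIterLr T P) (hinj : InjOn T (Ico (0 : ℝ) 1)) {x : ℝ}
    (hx : x ∈ Ico (0 : ℝ) 1) (m k : ℤ) : P m (P k x) = P (m + k) x := by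
  have hk := (hP.2 k x hx).1
  induction m with
  | zero => simpa using hP.1 _ hk
  | succ m ih =>
    rw [(hP.2 _ _ hk).2, ih, ← (hP.2 _ _ hx).2]
    congr 1
    ring
  | pred m ih =>
    refine hinj (hP.2 _ _ hk).1 (hP.2 _ _ hx).1 ?_
    rw [← (hP.2 _ _ hk).2, ← (hP.2 _ _ hx).2, sub_add_cancel, ih]
    congr 1
    ring

theorem IsZIterLr.apply_natCast_add (hP : IsZIterLr T P) {x : ℝ} (hx : x ∈ Ico (0 : ℝ) 1)
    (k : ℤ) (m : ℕ) : P (k + m) x = T^[m] (P k x) := by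
  induction m with
  | zero => simp
  | succ m ih =>
    rw [Function.iterate_succ_apply', ← ih, ← (hP.2 _ _ hx).2]
    push_cast
    rw [add_assoc]

theorem IsZIterLr.orbit_injective (hP : IsZIterLr T P)
    (hnoper : ¬ ∃ x ∈ Ico (0 : ℝ) 1, ∃ k : ℕ, 1 ≤ k ∧ T^[k] x = x) {x : ℝ}
    (hx : x ∈ Ico (0 : ℝ) 1) : Function.Injective fun k => P k x := by
  have hlt : ∀ j k : ℤ, j < k → P j x ≠ P k x := by
    intro j k hjk h
    obtain ⟨m, rfl⟩ := Int.le.dest hjk.le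
    refine hnoper ⟨P j x, (hP.2 j x hx).1, m, by omega, ?_⟩
    rw [← hP.apply_natCast_add hx, h]
  intro j k h
  by_contra hne
  rcases lt_or_gt_of_ne hne with h' | h'
  · exact hlt _ _ h' h
  · exact hlt _ _ h' h.symm

theorem mem_Ico_of_mem_Rset {x : ℝ} (hx : x ∈ Rset a P) : x ∈ Ico (0 : ℝ) 1 := by
  refine ⟨hx.1.1, lt_of_le_of_ne hx.1.2 ?_⟩
  rintro rfl
  exact hx.2 (Or.inl (by simp))

theorem bpt_lt_of_mem_Rset (ha : ∀ i, 0 ≤ a i) (hT : IsLrIET a τ T) (hP : IsZIterLr T P)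
    (hI : IsItin a P I) (hnoper : ¬ ∃ x ∈ Ico (0 : ℝ) 1, ∃ k : ℕ, 1 ≤ k ∧ T^[k] x = x)
    {x : ℝ} (hx : x ∈ Rset a P) (k : ℤ) : bpt a (I x k : ℕ) < P k x := by
  have hxI := mem_Ico_of_mem_Rset hx
  have hadd := fun m k => hP.apply_add (hT.injOn ha hP hI) hxI m k
  have hD : ∀ k, P k x ∉ Dset a := by
    intro k hk
    refine hx.2 (Or.inr (mem_iUnion.2 ⟨-k, P k x, hk, ?_⟩))
    rw [hadd, neg_add_cancel, hP.1 _ hxI]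
  have hendpoint : ∀ k, bpt a (I x k : ℕ) = P k x → (I x k : ℕ) = 0 := by
    intro k h
    by_contra h0
    exact hD k ⟨_, Nat.pos_of_ne_zero h0, (I x k).isLt, h.symm⟩
  refine lt_of_le_of_ne (hI.mem_Jint hxI k).1 fun heq => ?_
  have hk0 : P k x = 0 := by rw [← heq, hendpoint k heq, bpt_zero]
  have hTk : T (P (k - 1) x) = 0 := by
    rw [← (hP.2 _ _ hxI).2, sub_add_cancel, hk0]
  have hJ := hI.mem_Jint hxI (k - 1)
  have heq' : bpt a (I x (k - 1) : ℕ) = P (k - 1) x := by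
    have h1 := hT _ _ hJ
    have h2 := bpt_nonneg (a := aperm a τ) (fun i => ha (τ.symm i)) (τ (I x (k - 1)) : ℕ)
    rw [Jint, mem_Ico] at hJ
    linarith [hJ.1]
  have hk1 : P (k - 1) x = 0 := by rw [← heq', hendpoint _ heq', bpt_zero]
  have := hP.orbit_injective hnoper hxI (hk1.trans hk0.symm)
  omega

/-- Every point in the closure of the itineraries is realised by an orbit of the translations in
the closed intervals. -/
theorem exists_orbit_of_mem_closure (hT : IsLrIET a τ T) (hP : IsZIterLr T P)
    (hI : IsItin a P I) {β : ℤ → Fin n} (hβ : β ∈ closure (I '' Rset a P)) :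
    ∃ y : ℤ → ℝ, (∀ k, y k ∈ Icc (bpt a (β k : ℕ)) (bpt a (β k : ℕ) + a (β k))) ∧
      ∀ k, y (k + 1) = y k + (bpt (aperm a τ) (τ (β k) : ℕ) - bpt a (β k : ℕ)) := by
  obtain ⟨u, hu, huβ⟩ := mem_closure_iff_ultrafilter.1 hβ
  choose! g hg hIg using fun ω (hω : ω ∈ I '' Rset a P) => hω
  have hmem : ∀ k, ∀ᶠ ω in (u : Filter (ℤ → Fin n)), g ω ∈ Ico (0 : ℝ) 1 ∧
      P k (g ω) ∈ Jint a (β k) := by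
    intro k
    have hk : ∀ᶠ ω in (u : Filter (ℤ → Fin n)), ω k = β k := by
      have h : Filter.Tendsto (fun ω : ℤ → Fin n => ω k) (nhds β) (nhds (β k)) :=
        (continuous_apply k).tendsto β
      rw [nhds_discrete (Fin n), Filter.tendsto_pure] at h
      exact huβ h
    filter_upwards [hk, hu] with ω hω hωI
    have hx := mem_Ico_of_mem_Rset (hg ω hωI)
    exact ⟨hx, (hI _ hx _ _).1 (by rw [hIg ω hωI, hω])⟩
  have hlim : ∀ k, ∃ z ∈ Icc (bpt a (β k : ℕ)) (bpt a (β k : ℕ) + a (β k)),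
      Filter.Tendsto (fun ω => P k (g ω)) u (nhds z) := by
    intro k
    refine isCompact_Icc.ultrafilter_le_nhds (u.map fun ω => P k (g ω)) ?_
    rw [Filter.le_principal_iff]
    refine (hmem k).mono fun ω hω => ?_
    rw [← bpt_succ]
    exact Ico_subset_Icc_self hω.2
  choose y hy hylim using hlim
  refine ⟨y, hy, fun k => tendsto_nhds_unique (hylim (k + 1)) ?_⟩
  refine ((hylim k).add_const _).congr' ?_
  filter_upwards [hmem k] with ω hω
  rw [(hP.2 k _ hω.1).2, hT _ _ hω.2]
  ring

end Orbit

/-- Theorem 4.4 (iii): if `T` has no periodic points, `α ≠ β` are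
points of `X` and `α ∈ X₀`, then the pair `α, β` is neither positively nor
negatively asymptotic. -/
theorem stmt13 {n : ℕ} (hn : 2 ≤ n) (a : Fin n → ℝ) (ha : IsProbVec a)
    (τ : Equiv.Perm (Fin n)) (T Tt : ℝ → ℝ)
    (hT : IsLrIET a τ T) (hTt : IslRIET a τ Tt)
    (P Pt : ℤ → ℝ → ℝ) (hP : IsZIterLr T P) (hPt : IsZIterlR Tt Pt)
    (I It : ℝ → ℤ → Fin n) (hI : IsItin a P I) (hIt : IsItinDual a Pt It)
    (hnoper : ¬ ∃ x ∈ Set.Ico (0 : ℝ) 1, ∃ k : ℕ, 1 ≤ k ∧ T^[k] x = x)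
    (α β : ℤ → Fin n) (hα : α ∈ I '' Rset a P)
    (hβ : β ∈ closure (I '' Rset a P)) (hne : α ≠ β) :
    ¬ PosAsymp α β ∧ ¬ NegAsymp α β := by
  obtain ⟨x, hx, rfl⟩ := hα
  have ha0 : ∀ i, 0 ≤ a i := fun i => (ha.1 i).le
  have hxI := mem_Ico_of_mem_Rset hx
  obtain ⟨y, hy, hy_succ⟩ := exists_orbit_of_mem_closure hT hP hI hβ
  have hl : ∀ i j : Fin n, i ≠ j →
      bpt a (i : ℕ) + a i ≤ bpt a (j : ℕ) ∨ bpt a (j : ℕ) + a j ≤ bpt a (i : ℕ) :=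
    fun i j h => bpt_not_overlap ha0 h
  have hlt : ∀ i j : Fin n, i ≠ j →
      bpt a (i : ℕ) + (bpt (aperm a τ) (τ i : ℕ) - bpt a (i : ℕ)) + a i ≤
        bpt a (j : ℕ) + (bpt (aperm a τ) (τ j : ℕ) - bpt a (j : ℕ)) ∨
      bpt a (j : ℕ) + (bpt (aperm a τ) (τ j : ℕ) - bpt a (j : ℕ)) + a j ≤
        bpt a (i : ℕ) + (bpt (aperm a τ) (τ i : ℕ) - bpt a (i : ℕ)) := by
    intro i j h
    simpa only [add_sub_cancel] using bpt_aperm_not_overlap ha0 τ h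
  have hxJ : ∀ k, bpt a (I x k : ℕ) < P k x ∧ P k x < bpt a (I x k : ℕ) + a (I x k) := by
    intro k
    refine ⟨bpt_lt_of_mem_Rset ha0 hT hP hI hnoper hx k, ?_⟩
    rw [← bpt_succ]
    exact (hI.mem_Jint hxI k).2
  have hx_succ : ∀ k, P (k + 1) x =
      P k x + (bpt (aperm a τ) (τ (I x k) : ℕ) - bpt a (I x k : ℕ)) := by
    intro k
    rw [(hP.2 k x hxI).2, hT _ _ (hI.mem_Jint hxI k)]
    ring
  have hx_mem : ∀ k, P k x ∈ Icc (0 : ℝ) 1 := fun k => Ico_subset_Icc_self (hP.2 k x hxI).1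
  have hx_inj := hP.orbit_injective hnoper hxI
  constructor
  · rintro ⟨N, hN⟩
    exact hne (itinerary_eq_of_eventually_eq (l := fun i : Fin n => bpt a (i : ℕ)) (w := a)
      (t := fun i : Fin n => bpt (aperm a τ) (τ i : ℕ) - bpt a (i : ℕ)) (x := fun k => P k x)
      hl hlt hxJ hy hx_succ hy_succ hx_mem hx_inj hN)
  · rintro ⟨N, hN⟩
    exact hne (itinerary_eq_of_eventually_eq_atBot (l := fun i : Fin n => bpt a (i : ℕ)) (w := a)
      (t := fun i : Fin n => bpt (aperm a τ) (τ i : ℕ) - bpt a (i : ℕ)) (x := fun k => P k x)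
      hl hlt hxJ hy hx_succ hy_succ hx_mem hx_inj hN)
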